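/- Let z₀ ∈ Γ, let y ∈ Γ with y ≠ z₀ and let x₀ = z₀ − ℓ n(z₀) with 0 < ℓ < reach(Γ, z₀). If, in local graph coordinates at z₀ with graph function h satisfying |h(y')| ≤ nK|y'|², the point y = (y', h(y')) has h(y') > 0, then Federer's reach inequality reach(Γ, z₀) ≥ −|z₀−y|²|x₀−z₀| / (2 (x₀−z₀)·(z₀−y)) implies reach(Γ, z₀) ≥ (1/2)(|y'|²/h(y') + h(y')) ≥ 1/(2nK). -/

import Mathlib

open Metric Set
open scoped RealInnerProductSpace

noncomputable section

theorem stmt_7 (n : ℕ) (hn : 2 ≤ n) (K : ℝ) (hK : 0 < K)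
    (z₀ y x₀ ν v : EuclideanSpace ℝ (Fin n)) (a ℓ R : ℝ)
    (hν : ‖ν‖ = 1) (hv : ⟪v, ν⟫ = 0)
    -- `y = (y', h(y'))` in local graph coordinates at `z₀`, with tangential part `v`
    -- and height `a = h(y') > 0` in the inward direction `-ν`
    (hy : y = z₀ + v - a • ν) (ha : 0 < a) (haK : a ≤ n * K * ‖v‖ ^ 2)
    (hyne : y ≠ z₀)
    (hℓ : 0 < ℓ) (hx₀ : x₀ = z₀ - ℓ • ν)
    -- Federer's reach inequality
    (hFed : R ≥ -(‖z₀ - y‖ ^ 2 * ‖x₀ - z₀‖) / (2 * ⟪x₀ - z₀, z₀ - y⟫)) :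
    R ≥ (1 / 2) * (‖v‖ ^ 2 / a + a) ∧ (1 / 2) * (‖v‖ ^ 2 / a + a) ≥ 1 / (2 * n * K) := by
  have hνν : ⟪ν, ν⟫ = (1 : ℝ) := by rw [real_inner_self_eq_norm_sq, hν]; norm_num
  have hv' : ⟪ν, v⟫ = (0 : ℝ) := by rw [real_inner_comm]; exact hv
  have h1 : x₀ - z₀ = -(ℓ • ν) := by rw [hx₀]; abel
  have h2 : z₀ - y = a • ν - v := by rw [hy]; abel
  have h3 : ‖x₀ - z₀‖ = ℓ := by
    rw [h1, norm_neg, norm_smul, hν, Real.norm_of_nonneg hℓ.le, mul_one]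
  have h4 : ⟪x₀ - z₀, z₀ - y⟫ = -(ℓ * a) := by
    rw [h1, h2, inner_neg_left, inner_sub_right, real_inner_smul_left, real_inner_smul_left,
      real_inner_smul_right, hνν, hv']
    ring
  have h5 : ‖z₀ - y‖ ^ 2 = a ^ 2 + ‖v‖ ^ 2 := by
    rw [h2, norm_sub_sq_real, norm_smul, hν, real_inner_smul_left, hv', mul_one,
      Real.norm_of_nonneg ha.le]
    ring
  have hn0 : (0 : ℝ) < n := by
    have : 0 < n := by omega
    exact_mod_cast this
  constructor
  · rw [h3, h4, h5] at hFed
    have h6 : -((a ^ 2 + ‖v‖ ^ 2) * ℓ) / (2 * -(ℓ * a)) = (1 / 2) * (‖v‖ ^ 2 / a + a) := by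
      field_simp
      ring
    rw [h6] at hFed
    exact hFed
  · have hnK : 0 < (n : ℝ) * K := mul_pos hn0 hK
    have h7 : 1 / ((n : ℝ) * K) ≤ ‖v‖ ^ 2 / a := by
      rw [div_le_div_iff₀ hnK ha]
      linarith
    have h8 : 1 / (2 * (n : ℝ) * K) = (1 / 2) * (1 / ((n : ℝ) * K)) := by
      field_simp
    rw [h8]
    linarith
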